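/- For every n ≥ 0 and every 0 < s ≤ t, the conditional expectation of M_n(X_t, t) given the σ-algebra F_{≤s} = σ(X_u : 0 ≤ u ≤ s) equals M_n(X_s, s) almost surely; in other words, (M_n(X_t,t), F_{≤t})_{t>0} is a martingale. -/

import Mathlib

open MeasureTheory ProbabilityTheory Filter

/-- Moment functions `m_n(t)` defined recursively from the cumulant sequence `c`:
`m_0(t) = 1`, `m_{n+1}(t) = t * Σ_{j=0}^n C(n,j) c_{j+1} m_{n-j}(t)`. -/
noncomputable def mo (c : ℕ → ℝ) : ℕ → ℝ → ℝ
  | 0 => fun _ => 1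
  | n + 1 => fun t =>
      t * ∑ j ∈ Finset.range (n + 1), (n.choose j : ℝ) * c (j + 1) * mo c (n - j) t
  decreasing_by omega

/-- The polynomial martingales `M_n(x,t) = Σ_{j=0}^n C(n,j) m_{n-j}(-t) x^j`. -/
noncomputable def Mp (c : ℕ → ℝ) (n : ℕ) (x t : ℝ) : ℝ :=
  ∑ j ∈ Finset.range (n + 1), (n.choose j : ℝ) * mo c (n - j) (-t) * x ^ j

/-- `X` is a real-valued Lévy process under `P`: starts at `0` a.s., has stationary
increments, and independent increments over any increasing sequence of times. -/
structure IsLevy {Ω : Type*} [MeasurableSpace Ω] (P : Measure Ω) (X : ℝ → Ω → ℝ) : Prop where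
  measurable : ∀ t : ℝ, Measurable (X t)
  init : ∀ᵐ ω ∂P, X 0 ω = 0
  stationary : ∀ s t : ℝ, 0 ≤ s → s ≤ t →
    Measure.map (fun ω => X t ω - X s ω) P = Measure.map (X (t - s)) P
  indep : ∀ (m : ℕ) (ts : Fin (m + 1) → ℝ), (∀ i, 0 ≤ ts i) → Monotone ts →
    iIndepFun (m := fun _ : Fin m => (inferInstance : MeasurableSpace ℝ))
      (fun i ω => X (ts i.succ) ω - X (ts i.castSucc) ω) P

/-- The σ-algebra `F_{≤ s} = σ(X_u : 0 ≤ u ≤ s)`. -/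
def filtLE {Ω : Type*} [MeasurableSpace Ω] (X : ℝ → Ω → ℝ) (s : ℝ) : MeasurableSpace Ω :=
  ⨆ u ∈ Set.Icc (0 : ℝ) s, MeasurableSpace.comap (X u) inferInstance

/-- The σ-algebra `F_{≥ t} = σ(X_u : u ≥ t)`. -/
def filtGE {Ω : Type*} [MeasurableSpace Ω] (X : ℝ → Ω → ℝ) (t : ℝ) : MeasurableSpace Ω :=
  ⨆ u ∈ Set.Ici t, MeasurableSpace.comap (X u) inferInstance


theorem levy_indep {Ω : Type*} [MeasurableSpace Ω] (P : Measure Ω) [IsProbabilityMeasure P]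
    (X : ℝ → Ω → ℝ) (hX : IsLevy P X) (s t : ℝ) (hs : 0 < s) (hst : s ≤ t) :
    IndepFun (fun ω (u : Set.Icc (0:ℝ) s) => X u ω) (fun ω => X t ω - X s ω) P := by
  have hinc : HasIndepIncrements (fun r ω => X (max r 0) ω) P := by
    intro n ts hts
    exact hX.indep n (fun i => max (ts i) 0) (fun i => le_max_right _ _)
      (fun i j hij => max_le_max (hts hij) le_rfl)
  refine IndepFun.process_indepFun (fun i => hX.measurable _)
    ((hX.measurable t).sub (hX.measurable s)) ?_
  intro I
  let J : Finset ℝ := insert 0 (insert s (I.image Subtype.val))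
  have hJ : ∀ x ∈ J, 0 ≤ x ∧ x ≤ s := by
    intro x hx
    simp only [J, Finset.mem_insert, Finset.mem_image] at hx
    rcases hx with rfl | rfl | ⟨a, _, rfl⟩
    · exact ⟨le_rfl, hs.le⟩
    · exact ⟨hs.le, le_rfl⟩
    · exact a.2
  obtain ⟨k, hk⟩ : ∃ k, J.card = k + 1 :=
    ⟨J.card - 1, by
      have : 0 < J.card := Finset.card_pos.2 ⟨0, by simp [J]⟩
      omega⟩
  let e := J.orderEmbOfFin hk
  let ts : ℕ → ℝ := fun i => if h : i < k + 1 then e ⟨i, h⟩ else t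
  have hts : Monotone ts := by
    intro i j hij
    simp only [ts]
    split_ifs with h1 h2 h2
    · exact e.monotone hij
    · exact ((hJ _ (Finset.orderEmbOfFin_mem J hk _)).2).trans hst
    · omega
    · exact le_rfl
  have hsurj : ∀ x ∈ J, ∃ i, i ≤ k ∧ ts i = x := by
    intro x hx
    have : x ∈ Set.range e := by rw [Finset.range_orderEmbOfFin]; exact hx
    obtain ⟨i, rfl⟩ := this
    exact ⟨i, by omega, by simp only [ts, i.2, dif_pos]⟩
  have hmem : ∀ i, i ≤ k → ts i ∈ J := by
    intro i hi
    have h : i < k + 1 := by omega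
    simp only [ts, h, dif_pos]
    exact Finset.orderEmbOfFin_mem J hk _
  have h0 : ts 0 = 0 := by
    obtain ⟨i, hi, hi'⟩ := hsurj 0 (by simp [J])
    exact le_antisymm (hi' ▸ hts (Nat.zero_le i)) (hJ _ (hmem 0 (Nat.zero_le _))).1
  have hks : ts k = s := by
    obtain ⟨i, hi, hi'⟩ := hsurj s (by simp [J])
    exact le_antisymm (hJ _ (hmem k le_rfl)).2 (hi' ▸ hts hi)
  have hkt : ts (k+1) = t := by simp [ts]
  have hpos : ∀ i, 0 ≤ ts i := fun i => h0 ▸ hts (Nat.zero_le i)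
  have hind := hinc.nat hts
  simp only [fun i => max_eq_left (hpos i)] at hind
  have h2 := hind.indepFun_finset (Finset.range k) {k} (by simp)
    (fun i => (hX.measurable _).sub (hX.measurable _))
  choose! idx hidx1 hidx2 using hsurj
  have hIJ : ∀ u : I, (u : Set.Icc (0:ℝ) s).1 ∈ J := by
    intro u
    simp only [J, Finset.mem_insert, Finset.mem_image]
    exact Or.inr (Or.inr ⟨u.1, u.2, rfl⟩)
  let φ : ((Finset.range k) → ℝ) → (I → ℝ) := fun v u =>
    ∑ j : Finset.range k, if j.1 < idx (u : Set.Icc (0:ℝ) s).1 then v j else 0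
  have hφ : Measurable φ := by
    refine measurable_pi_lambda _ fun u => ?_
    refine Finset.measurable_sum _ fun j _ => ?_
    split_ifs
    · exact measurable_pi_apply j
    · exact measurable_const
  have h3 := h2.comp hφ (measurable_pi_apply (⟨k, by simp⟩ : ({k} : Finset ℕ)))
  refine h3.congr ?_ ?_
  · filter_upwards [hX.init] with ω hω
    funext u
    simp only [φ, Function.comp]
    rw [Finset.sum_coe_sort (Finset.range k)
      (fun j => if j < idx (u : Set.Icc (0:ℝ) s).1 then X (ts (j+1)) ω - X (ts j) ω else 0),
      ← Finset.sum_filter]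
    have : (Finset.range k).filter (fun j => j < idx (u : Set.Icc (0:ℝ) s).1)
        = Finset.range (idx (u : Set.Icc (0:ℝ) s).1) := by
      ext j
      have := hidx1 _ (hIJ u)
      simp only [Finset.mem_filter, Finset.mem_range]
      omega
    rw [this, Finset.sum_range_sub (fun j => X (ts j) ω), h0, hω, hidx2 _ (hIJ u), sub_zero]
  · filter_upwards with ω
    simp [hks, hkt]

theorem filtLE_eq {Ω : Type*} [MeasurableSpace Ω] (X : ℝ → Ω → ℝ) (s : ℝ) :
    filtLE X s = MeasurableSpace.comap (fun ω (u : Set.Icc (0:ℝ) s) => X u ω) inferInstance := by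
  change _ = MeasurableSpace.comap _ MeasurableSpace.pi
  simp only [filtLE, MeasurableSpace.pi, MeasurableSpace.comap_iSup, MeasurableSpace.comap_comp,
    iSup_subtype']
  rfl

open PowerSeries in
theorem ps_unique (G A B : PowerSeries ℝ) (hA : d⁄dX ℝ A = G * A) (hB : d⁄dX ℝ B = G * B)
    (h0 : coeff 0 A = coeff 0 B) : A = B := by
  ext n
  induction n using Nat.strong_induction_on with
  | _ n ih =>
    cases n with
    | zero => exact h0
    | succ n =>
      have h1 := congrArg (coeff n) hA
      have h2 := congrArg (coeff n) hB
      rw [coeff_derivative, coeff_mul] at h1 h2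
      have : (coeff (n+1) A) * ((n:ℝ)+1) = (coeff (n+1) B) * ((n:ℝ)+1) := by
        rw [h1, h2]
        refine Finset.sum_congr rfl fun p hp => ?_
        rw [ih p.2 (by have := Finset.HasAntidiagonal.mem_antidiagonal.1 hp; omega)]
      exact mul_right_cancel₀ (by positivity) this

/-- Exponential generating series. -/
noncomputable def egs (a : ℕ → ℝ) : PowerSeries ℝ := PowerSeries.mk fun n => a n / n.factorial

theorem egs_mul (a b : ℕ → ℝ) : egs a * egs b =
    egs fun n => ∑ j ∈ Finset.range (n+1), (n.choose j : ℝ) * a j * b (n - j) := by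
  ext n
  simp only [egs, PowerSeries.coeff_mul, PowerSeries.coeff_mk]
  rw [Finset.Nat.sum_antidiagonal_eq_sum_range_succ_mk, Finset.sum_div]
  refine Finset.sum_congr rfl fun j hj => ?_
  have hj' : j ≤ n := by simpa [Nat.lt_succ_iff] using hj
  rw [Nat.cast_choose ℝ hj']
  have := Nat.factorial_ne_zero n
  field_simp

theorem egs_inj {a b : ℕ → ℝ} (h : egs a = egs b) (n : ℕ) : a n = b n := by
  have := congrArg (PowerSeries.coeff n) h
  simp only [egs, PowerSeries.coeff_mk] at this
  have h' : (n.factorial : ℝ) ≠ 0 := by positivity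
  field_simp at this
  exact this

open PowerSeries in
theorem egs_mo_deriv (c : ℕ → ℝ) (t : ℝ) : d⁄dX ℝ (egs fun n => mo c n t) =
    (C t * egs fun j => c (j+1)) * egs fun n => mo c n t := by
  rw [mul_assoc, egs_mul]
  ext n
  rw [coeff_derivative, coeff_C_mul]
  simp only [egs, coeff_mk]
  rw [mo, Nat.factorial_succ]
  push_cast
  have h' : (n.factorial : ℝ) ≠ 0 := by positivity
  have h'' : (n : ℝ) + 1 ≠ 0 := by positivity
  field_simp

theorem egs_mo_add (c : ℕ → ℝ) (s t : ℝ) :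
    (egs fun n => mo c n s) * (egs fun n => mo c n t) = egs fun n => mo c n (s + t) := by
  refine ps_unique _ _ _ ?_ (egs_mo_deriv c (s+t)) ?_
  · rw [Derivation.leibniz, egs_mo_deriv, egs_mo_deriv, map_add]
    simp only [smul_eq_mul]
    ring
  · simp [egs, mo]

theorem Mp_egs (c : ℕ → ℝ) (x t : ℝ) :
    (egs fun n => Mp c n x t) = (egs fun n => x ^ n) * egs fun n => mo c n (-t) := by
  rw [egs_mul]
  congr 1; funext n
  exact Finset.sum_congr rfl fun j _ => by ring

/-- Addition formula. -/
theorem Mp_add (c : ℕ → ℝ) (n : ℕ) (x y t : ℝ) :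
    Mp c n (x + y) t = ∑ j ∈ Finset.range (n+1), (n.choose j : ℝ) * Mp c j x t * y ^ (n - j) := by
  have : (egs fun n => Mp c n (x+y) t) = (egs fun n => Mp c n x t) * egs fun n => y ^ n := by
    have h : (egs fun n => (x+y)^n) = (egs fun n => x ^ n) * egs fun n => y ^ n := by
      rw [egs_mul]
      congr 1; funext n
      rw [add_pow]
      exact Finset.sum_congr rfl fun j _ => by ring
    rw [Mp_egs, Mp_egs, h]; ring
  rw [egs_mul] at this
  exact egs_inj this n

theorem Mp_shift (c : ℕ → ℝ) (n : ℕ) (x s t : ℝ) :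
    ∑ j ∈ Finset.range (n+1), (n.choose j : ℝ) * Mp c j x t * mo c (n - j) (t - s)
      = Mp c n x s := by
  have : (egs fun n => Mp c n x t) * (egs fun n => mo c n (t - s)) = egs fun n => Mp c n x s := by
    rw [Mp_egs, Mp_egs, mul_assoc, egs_mo_add]
    congr 3; funext n; congr 1; ring
  rw [egs_mul] at this
  exact egs_inj this n

theorem stmt_4 {Ω : Type*} [MeasurableSpace Ω] (P : Measure Ω) [IsProbabilityMeasure P]
    (X : ℝ → Ω → ℝ) (c : ℕ → ℝ) (hX : IsLevy P X)
    (hmom : ∀ (n : ℕ) (t : ℝ), 0 ≤ t → Integrable (fun ω => |X t ω| ^ n) P)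
    (hm : ∀ (n : ℕ) (t : ℝ), 0 ≤ t → (∫ ω, (X t ω) ^ n ∂P) = mo c n t)
    (n : ℕ) (s t : ℝ) (hs : 0 < s) (hst : s ≤ t) :
    P[(fun ω => Mp c n (X t ω) t) | filtLE X s] =ᵐ[P] fun ω => Mp c n (X s ω) s := by
  have hind := levy_indep P X hX s t hs hst
  have hYm : Measurable (fun ω => X t ω - X s ω) := (hX.measurable t).sub (hX.measurable s)
  have hle : filtLE X s ≤ ‹MeasurableSpace Ω› :=
    iSup₂_le fun u _ => (hX.measurable u).comap_le
  have hXs : Measurable[filtLE X s] (X s) := by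
    refine Measurable.mono (comap_measurable (X s)) ?_ le_rfl
    exact le_iSup₂_of_le (f := fun u (_ : u ∈ Set.Icc (0:ℝ) s) =>
      MeasurableSpace.comap (X u) inferInstance) s ⟨hs.le, le_rfl⟩ le_rfl
  -- powers are integrable
  have hpow : ∀ (k : ℕ) (u : ℝ), 0 ≤ u → Integrable (fun ω => X u ω ^ k) P := by
    intro k u hu
    refine (hmom k u hu).mono ((hX.measurable u).pow_const k).aestronglyMeasurable ?_
    filter_upwards with ω
    simp
  have hts : 0 ≤ t - s := by linarith
  have hYpow : ∀ k : ℕ, Integrable (fun ω => (X t ω - X s ω) ^ k) P ∧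
      ∫ ω, (X t ω - X s ω) ^ k ∂P = mo c k (t - s) := by
    intro k
    have hid : IdentDistrib (fun ω => X t ω - X s ω) (X (t - s)) P P :=
      ⟨hYm.aemeasurable, (hX.measurable _).aemeasurable, hX.stationary s t hs.le hst⟩
    have hid' := hid.comp (u := fun x : ℝ => x ^ k) (by fun_prop)
    refine ⟨hid'.integrable_iff.2 (hpow k _ hts), ?_⟩
    rw [← hm k _ hts]
    exact hid'.integral_eq
  have hMpm : ∀ j, Measurable (fun x => Mp c j x t) := by
    intro j; unfold Mp; fun_prop
  have hMpint : ∀ j, Integrable (fun ω => Mp c j (X s ω) t) P := by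
    intro j
    unfold Mp
    exact integrable_finset_sum _ fun i _ => (hpow i s hs.le).const_mul _
  have hXsY : IndepFun (X s) (fun ω => X t ω - X s ω) P :=
    hind.comp (measurable_pi_apply (⟨s, hs.le, le_rfl⟩ : Set.Icc (0:ℝ) s)) measurable_id
  let F : ℕ → Ω → ℝ := fun j ω => ((n.choose j : ℝ) * Mp c j (X s ω) t)
  let G : ℕ → Ω → ℝ := fun j ω => (X t ω - X s ω) ^ (n - j)
  have hFG : ∀ j, Integrable (F j * G j) P := by
    intro j
    refine IndepFun.integrable_mul ?_ ((hMpint j).const_mul _) (hYpow _).1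
    exact hXsY.comp (φ := fun x => (n.choose j : ℝ) * Mp c j x t) (ψ := fun y => y ^ (n - j))
      ((hMpm j).const_mul _) (by fun_prop)
  have hdec : (fun ω => Mp c n (X t ω) t) = ∑ j ∈ Finset.range (n+1), F j * G j := by
    funext ω
    rw [Finset.sum_apply]
    have := Mp_add c n (X s ω) (X t ω - X s ω) t
    rw [add_sub_cancel] at this
    exact this
  have hterm : ∀ j, P[F j * G j | filtLE X s] =ᵐ[P] fun ω => F j ω * mo c (n - j) (t - s) := by
    intro j
    have h1 : P[F j * G j | filtLE X s] =ᵐ[P] F j * P[G j | filtLE X s] :=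
      condExp_mul_of_stronglyMeasurable_left
        (((hMpm j).comp hXs).const_mul _).stronglyMeasurable (hFG j) (hYpow _).1
    have h2 : P[G j | filtLE X s] =ᵐ[P] fun _ => P[G j] := by
      refine condExp_indep_eq hYm.comap_le hle
        ((comap_measurable _).pow_const _).stronglyMeasurable ?_
      rw [filtLE_eq]
      exact hind.symm
    filter_upwards [h1, h2] with ω h1 h2
    rw [h1, Pi.mul_apply, h2, (hYpow (n - j)).2]
  rw [hdec]
  refine (condExp_finsetSum (fun j _ => hFG j) _).trans ?_
  have hall : ∀ᵐ ω ∂P, ∀ j, (P[F j * G j | filtLE X s]) ω = F j ω * mo c (n - j) (t - s) :=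
    ae_all_iff.2 hterm
  filter_upwards [hall] with ω hω
  rw [Finset.sum_apply, ← Mp_shift c n (X s ω) s t]
  exact Finset.sum_congr rfl fun j _ => hω j
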